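/- Let P be an n-Vee with P⁺ = P ∪ {∞}, K a field, let I be a convex representation of P with support S, let x' be the minimal element of S (which is unique since P is an n-Vee), and let θ be a translation on P⁺. Then the following are equivalent: (a) there exists a nonzero morphism of representations from I to Iθ; (b) there exists x ∈ S with θx ∈ S; (c) θx' ∈ S. -/

import Mathlib

namespace GPM

/-- A translation on a preorder: a monotone map `Λ` with `x ≤ Λ x` for all `x`. -/
structure Translation (Q : Type*) [Preorder Q] where
  toFun : Q → Q
  mono : Monotone toFun
  le_apply : ∀ x, x ≤ toFun x

/-- A subset `S` is connected if any two of its elements can be joined by a finite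
sequence of elements of `S` in which consecutive elements are comparable. -/
def ConnectedIn {Q : Type*} [Preorder Q] (S : Set Q) : Prop :=
  ∀ x ∈ S, ∀ y ∈ S,
    Relation.ReflTransGen (fun a b => a ∈ S ∧ b ∈ S ∧ (a ≤ b ∨ b ≤ a)) x y

/-- `P` is an n-Vee with (unique) minimal element `m`: `m` is the unique minimal element,
the interval `[m, M]` is totally ordered for every maximal element `M`, and
`[m, M] ∩ [m, M'] = {m}` for distinct maximal elements `M, M'`. -/
structure IsNVee (P : Type*) [PartialOrder P] (m : P) : Prop where
  isMin : IsMin m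
  eq_of_isMin : ∀ p : P, IsMin p → p = m
  icc_chain : ∀ M : P, IsMax M → ∀ x ∈ Set.Icc m M, ∀ y ∈ Set.Icc m M, x ≤ y ∨ y ≤ x
  icc_inter : ∀ M M' : P, IsMax M → IsMax M' → M ≠ M' →
      Set.Icc m M ∩ Set.Icc m M' = {m}

/-- A representation of a poset `P` with values in `K`-vector spaces. -/
structure Rep (P : Type*) [Preorder P] (K : Type*) [Field K] where
  V : P → Type*
  [addCommGroup : ∀ p, AddCommGroup (V p)]
  [module : ∀ p, Module K (V p)]
  map : ∀ {p q : P}, p ≤ q → V p →ₗ[K] V q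
  map_refl : ∀ p : P, map (le_refl p) = LinearMap.id
  map_comp : ∀ {p q r : P} (hpq : p ≤ q) (hqr : q ≤ r),
      (map hqr).comp (map hpq) = map (hpq.trans hqr)

attribute [instance] Rep.addCommGroup Rep.module

/-- A morphism of representations (a natural transformation). -/
structure RepHom {P : Type*} [Preorder P] {K : Type*} [Field K] (M N : Rep P K) where
  app : ∀ p, M.V p →ₗ[K] N.V p
  natural : ∀ {p q : P} (h : p ≤ q), (N.map h).comp (app p) = (app q).comp (M.map h)

/-- The shift `MΛ : p ↦ M(Λ p)` of a representation by a translation. -/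
def Rep.shift {P : Type*} [Preorder P] {K : Type*} [Field K]
    (M : Rep P K) (Λ : Translation P) : Rep P K where
  V p := M.V (Λ.toFun p)
  map h := M.map (Λ.mono h)
  map_refl p := M.map_refl (Λ.toFun p)
  map_comp h1 h2 := M.map_comp (Λ.mono h1) (Λ.mono h2)

/-- The submodule of `K` underlying the convex representation of `S` at the point `p`:
all of `K` on `S`, and `0` off `S`. -/
noncomputable def convexSub (K : Type*) [Field K] {Q : Type*} (S : Set Q) (p : Q) :
    Submodule K K :=
  @ite _ (p ∈ S) (Classical.dec _) ⊤ ⊥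

theorem convexSub_pos (K : Type*) [Field K] {Q : Type*} {S : Set Q} {p : Q} (h : p ∈ S) :
    convexSub K S p = ⊤ := by
  rw [convexSub, if_pos h]

theorem convexSub_neg (K : Type*) [Field K] {Q : Type*} {S : Set Q} {p : Q} (h : p ∉ S) :
    convexSub K S p = ⊥ := by
  rw [convexSub, if_neg h]

/-- The canonical map between the fibers of the convex representations of `S` and `T`:
the identity of `K` when both fibers are `K`, and zero otherwise. -/
noncomputable def phiMap (K : Type*) [Field K] {Q : Type*} (S T : Set Q) (p q : Q) :
    ↥(convexSub K S p) →ₗ[K] ↥(convexSub K T q) :=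
  @dite _ (p ∈ S ∧ q ∈ T) (Classical.dec _)
    (fun h => Submodule.inclusion (le_of_eq (by rw [convexSub_pos K h.1, convexSub_pos K h.2])))
    (fun _ => 0)

theorem phiMap_neg (K : Type*) [Field K] {Q : Type*} {S T : Set Q} {p q : Q}
    (h : ¬(p ∈ S ∧ q ∈ T)) : phiMap K S T p q = 0 := by
  rw [phiMap, dif_neg h]

/-- The convex representation with support the interval-convex set `S`:
`K` at points of `S`, `0` elsewhere, with identity structure maps inside `S`. -/
noncomputable def convexRep (K : Type*) [Field K] {Q : Type*} [Preorder Q]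
    (S : Set Q) (hS : S.OrdConnected) : Rep Q K where
  V p := ↥(convexSub K S p)
  map {p q} _ := phiMap K S S p q
  map_refl p := by
    show phiMap K S S p p = LinearMap.id
    by_cases hp : p ∈ S
    · rw [phiMap, dif_pos ⟨hp, hp⟩]
      rfl
    · rw [phiMap_neg (K := K) (by tauto)]
      apply LinearMap.ext
      intro x
      have hx : x = 0 := by
        apply Subtype.ext
        have hle : convexSub K S p ≤ ⊥ := le_of_eq (convexSub_neg K hp)
        simpa using hle x.2
      simp [hx]
  map_comp {p q r} hpq hqr := by
    show (phiMap K S S q r).comp (phiMap K S S p q) = phiMap K S S p r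
    by_cases hp : p ∈ S
    · by_cases hr : r ∈ S
      · have hq : q ∈ S := hS.out hp hr ⟨hpq, hqr⟩
        rw [phiMap, phiMap, phiMap, dif_pos ⟨hq, hr⟩, dif_pos ⟨hp, hq⟩, dif_pos ⟨hp, hr⟩]
        rfl
      · rw [phiMap_neg (K := K) (S := S) (T := S) (p := q) (q := r) (by tauto),
          phiMap_neg (K := K) (S := S) (T := S) (p := p) (q := r) (by tauto)]
        simp
    · rw [phiMap_neg (K := K) (S := S) (T := S) (p := p) (q := q) (by tauto),
        phiMap_neg (K := K) (S := S) (T := S) (p := p) (q := r) (by tauto)]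
      simp

/-- In a finite n-Vee, any two elements below a common element are comparable. -/
theorem IsNVee.le_total_of_le {P : Type*} [PartialOrder P] [Finite P] {m : P}
    (hP : IsNVee P m) {y z a : P} (hy : y ≤ a) (hz : z ≤ a) : y ≤ z ∨ z ≤ y := by
  have bot : ∀ p : P, m ≤ p := fun p => by
    obtain ⟨b, hb, hmin⟩ := Finite.exists_le_minimal (p := fun _ : P => True) (a := p) trivial
    rwa [← hP.eq_of_isMin b fun c hc => hmin.2 trivial hc]
  obtain ⟨M, haM, hmax⟩ := Finite.exists_le_maximal (p := fun _ : P => True) (a := a) trivial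
  exact hP.icc_chain M (fun c hc => hmax.2 trivial hc) y ⟨bot y, hy.trans haM⟩
    z ⟨bot z, hz.trans haM⟩

/-- A minimal element of a connected subset of `P⁺` avoiding `∞` is its least element. -/
theorem IsNVee.le_of_minimal {P : Type*} [PartialOrder P] [Finite P] {m : P}
    (hP : IsNVee P m) {S : Set (WithTop P)} (hSconn : ConnectedIn S)
    (hStop : (⊤ : WithTop P) ∉ S) {x' : WithTop P} (hx'S : x' ∈ S)
    (hx'min : ∀ y ∈ S, y ≤ x' → y = x') {x : WithTop P} (hx : x ∈ S) : x' ≤ x := by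
  have comparable : ∀ {y z a : WithTop P}, a ∈ S → y ≤ a → z ≤ a → y ≤ z ∨ z ≤ y := by
    intro y z a ha hy hz
    lift a to P using fun h => hStop (h ▸ ha)
    obtain ⟨y, rfl, hy⟩ := WithTop.le_coe_iff.1 hy
    obtain ⟨z, rfl, hz⟩ := WithTop.le_coe_iff.1 hz
    simpa using hP.le_total_of_le (WithTop.coe_le_coe.1 hy) (WithTop.coe_le_coe.1 hz)
  induction hSconn x' hx'S x hx with
  | refl => exact le_rfl
  | tail _ hab ih =>
    obtain ⟨ha, hb, hab | hba⟩ := hab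
    · exact (ih ha).trans hab
    · rcases comparable ha (ih ha) hba with h | h
      · exact h
      · exact (hx'min _ hb h).ge

theorem phiMap_apply (K : Type*) [Field K] {Q : Type*} {S T : Set Q} {p q : Q}
    (h : p ∈ S ∧ q ∈ T) (v : convexSub K S p) : (phiMap K S T p q v : K) = v := by
  rw [phiMap, dif_pos h]
  rfl

/-- The composite of two canonical maps is canonical when the middle fiber is `K`
and zero when it vanishes. -/
theorem phiMap_comp_apply (K : Type*) [Field K] {Q : Type*} {S : Set Q} (p q r : Q)
    (v : convexSub K S p) [Decidable (p ∈ S ∧ q ∈ S ∧ r ∈ S)] :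
    (phiMap K S S q r (phiMap K S S p q v) : K) =
      if p ∈ S ∧ q ∈ S ∧ r ∈ S then (v : K) else 0 := by
  split_ifs with h
  · rw [phiMap_apply K h.2, phiMap_apply K ⟨h.1, h.2.1⟩]
  · by_cases hpq : p ∈ S ∧ q ∈ S
    · rw [phiMap_neg K fun hqr => h ⟨hpq.1, hqr⟩]
      rfl
    · rw [phiMap_neg K hpq]
      simp

/-- The canonical morphism from a convex representation to its shift by a translation. -/
noncomputable def convexRepToShift (K : Type*) [Field K] {Q : Type*} [Preorder Q] (S : Set Q)
    (hS : S.OrdConnected) (θ : Translation Q) :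
    RepHom (convexRep K S hS) ((convexRep K S hS).shift θ) where
  app p := phiMap K S S p (θ.toFun p)
  natural {p q} h := by
    classical
    refine LinearMap.ext fun v => Subtype.ext ?_
    have key : p ∈ S ∧ θ.toFun p ∈ S ∧ θ.toFun q ∈ S ↔ p ∈ S ∧ q ∈ S ∧ θ.toFun q ∈ S :=
      ⟨fun ⟨h1, _, h3⟩ => ⟨h1, hS.out h1 h3 ⟨h, θ.le_apply q⟩, h3⟩,
        fun ⟨h1, _, h3⟩ => ⟨h1, hS.out h1 h3 ⟨θ.le_apply p, θ.mono h⟩, h3⟩⟩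
    refine (phiMap_comp_apply K p (θ.toFun p) (θ.toFun q) v).trans ?_
    refine Eq.trans ?_ (phiMap_comp_apply K p q (θ.toFun q) v).symm
    simp only [key]

theorem convexSub_eq_zero (K : Type*) [Field K] {Q : Type*} {S : Set Q} {p : Q} (h : p ∉ S)
    (v : convexSub K S p) : v = 0 :=
  Subtype.ext ((Submodule.mem_bot K).1 (convexSub_neg K h ▸ v.2))

/-- Let `P` be an n-Vee, `I` a convex representation of `P` (viewed as
a representation of `P⁺ = P ∪ {∞}` vanishing at `∞`) with support `S`, `x'` the minimal
element of `S`, and `θ` a translation on `P⁺`.  The following are equivalent: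
(a) there is a nonzero morphism `I → Iθ`; (b) some `x ∈ S` has `θ x ∈ S`;
(c) `θ x' ∈ S`. -/
theorem statement8 {P : Type*} [PartialOrder P] [Finite P] (m : P) (hP : IsNVee P m)
    {K : Type*} [Field K]
    (S : Set (WithTop P)) (hSne : S.Nonempty) (hSconn : ConnectedIn S)
    (hSconv : S.OrdConnected) (hStop : (⊤ : WithTop P) ∉ S)
    (x' : WithTop P) (hx'S : x' ∈ S) (hx'min : ∀ y ∈ S, y ≤ x' → y = x')
    (θ : Translation (WithTop P)) :
    ((∃ f : RepHom (convexRep K S hSconv) ((convexRep K S hSconv).shift θ),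
        ∃ p, f.app p ≠ 0) ↔ (∃ x ∈ S, θ.toFun x ∈ S)) ∧
    ((∃ x ∈ S, θ.toFun x ∈ S) ↔ θ.toFun x' ∈ S) := by
  have hbc : (∃ x ∈ S, θ.toFun x ∈ S) ↔ θ.toFun x' ∈ S :=
    ⟨fun ⟨_, hx, hθx⟩ => hSconv.out hx'S hθx ⟨θ.le_apply x',
      θ.mono (hP.le_of_minimal hSconn hStop hx'S hx'min hx)⟩, fun h => ⟨x', hx'S, h⟩⟩
  refine ⟨⟨?_, ?_⟩, hbc⟩
  · rintro ⟨f, p, hf⟩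
    by_contra! hne
    refine hf (LinearMap.ext fun v => ?_)
    by_cases hp : p ∈ S
    · exact convexSub_eq_zero K (hne p hp) (f.app p v)
    · have hv : v = 0 := convexSub_eq_zero K hp v
      rw [hv, map_zero, map_zero]
  · rintro ⟨x, hx, hθx⟩
    refine ⟨convexRepToShift K S hSconv θ, x, fun h => one_ne_zero (α := K) ?_⟩
    have hone : (1 : K) ∈ convexSub K S x := by rw [convexSub_pos K hx]; trivial
    have hval := phiMap_apply K ⟨hx, hθx⟩ ⟨1, hone⟩
    rw [show phiMap K S S x (θ.toFun x) = 0 from h] at hval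
    exact hval.symm

end GPM
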